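/- Let 0 ≤ l1 < l2 ≤ 1, let z* ∈ (l1, l2), let a0 ≠ a1 be real numbers, and let g(t) = a0 for t ∈ [l1, z*) and g(t) = a1 for t ∈ [z*, l2]. Define A*(z) := ∫_{l1}^{z} g(t) dt − ((z − l1)/(l2 − l1)) ∫_{l1}^{l2} g(t) dt for z ∈ [l1, l2]. Then A*(z) = (a0 − a1)·(l2 − z*)·(z − l1)/(l2 − l1) for z ∈ [l1, z*], A*(z) = (a0 − a1)·(z* − l1)·(l2 − z)/(l2 − l1) for z ∈ [z*, l2], and |A*| has a unique maximum on [l1, l2] at z = z*, with maximal value |a0 − a1|·(z* − l1)·(l2 − z*)/(l2 − l1); i.e. |A*(z)| < |A*(z*)| for every z ∈ [l1, l2] with z ≠ z*. -/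

import Mathlib

open MeasureTheory intervalIntegral

theorem integral_eq_of_eqOn_Ioo_const {g : ℝ → ℝ} {a b c : ℝ} (hab : a ≤ b)
    (h : ∀ t ∈ Set.Ioo a b, g t = c) : ∫ t in a..b, g t = (b - a) * c := by
  rw [integral_congr_Ioo_of_le (g := fun _ => c) hab h, intervalIntegral.integral_const, smul_eq_mul]

theorem intervalIntegrable_of_eqOn_Ioo_const {g : ℝ → ℝ} {a b c : ℝ} (hab : a ≤ b)
    (h : ∀ t ∈ Set.Ioo a b, g t = c) : IntervalIntegrable g volume a b :=
  (intervalIntegrable_congr_uIoo (g := fun _ => c)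
    (by rw [Set.uIoo_of_le hab]; exact h)).2 intervalIntegrable_const

/-- For a two-level step function `g` with a single jump at `z* ∈ (l1, l2)`, the function
`A*` is explicitly piecewise affine and `|A*|` has a unique maximum at `z*` with value
`|a0 − a1|·(z* − l1)·(l2 − z*)/(l2 − l1)`. -/
theorem Astar_single_change_point
    (l1 l2 : ℝ) (hl1 : 0 ≤ l1) (hl12 : l1 < l2) (hl2 : l2 ≤ 1)
    (zs : ℝ) (hzs : zs ∈ Set.Ioo l1 l2)
    (a0 a1 : ℝ) (ha : a0 ≠ a1)
    (g : ℝ → ℝ)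
    (hg0 : ∀ t ∈ Set.Ico l1 zs, g t = a0)
    (hg1 : ∀ t ∈ Set.Icc zs l2, g t = a1)
    (A : ℝ → ℝ)
    (hA : ∀ z, A z = (∫ t in l1..z, g t) - (z - l1) / (l2 - l1) * ∫ t in l1..l2, g t) :
    (∀ z ∈ Set.Icc l1 zs, A z = (a0 - a1) * (l2 - zs) * (z - l1) / (l2 - l1)) ∧
    (∀ z ∈ Set.Icc zs l2, A z = (a0 - a1) * (zs - l1) * (l2 - z) / (l2 - l1)) ∧
    |A zs| = |a0 - a1| * (zs - l1) * (l2 - zs) / (l2 - l1) ∧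
    (∀ z ∈ Set.Icc l1 l2, z ≠ zs → |A z| < |A zs|) := by
  obtain ⟨h1, h2⟩ := hzs
  have hL : 0 < l2 - l1 := sub_pos.2 hl12
  have integral_left : ∀ z ∈ Set.Icc l1 zs, ∫ t in l1..z, g t = (z - l1) * a0 := fun z hz =>
    integral_eq_of_eqOn_Ioo_const hz.1 fun t ht => hg0 t ⟨ht.1.le, ht.2.trans_le hz.2⟩
  have integral_right : ∀ z ∈ Set.Icc zs l2,
      ∫ t in l1..z, g t = (zs - l1) * a0 + (z - zs) * a1 := by
    intro z hz
    have hr : ∀ t ∈ Set.Ioo zs z, g t = a1 := fun t ht => hg1 t ⟨ht.1.le, ht.2.le.trans hz.2⟩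
    have hl : ∀ t ∈ Set.Ioo l1 zs, g t = a0 := fun t ht => hg0 t ⟨ht.1.le, ht.2⟩
    rw [← integral_add_adjacent_intervals (intervalIntegrable_of_eqOn_Ioo_const h1.le hl)
      (intervalIntegrable_of_eqOn_Ioo_const hz.1 hr),
      integral_eq_of_eqOn_Ioo_const h1.le hl, integral_eq_of_eqOn_Ioo_const hz.1 hr]
  have A_left : ∀ z ∈ Set.Icc l1 zs,
      A z = (a0 - a1) * (l2 - zs) * (z - l1) / (l2 - l1) := by
    intro z hz
    rw [hA, integral_left z hz, integral_right l2 ⟨h2.le, le_rfl⟩]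
    field_simp
    ring
  have A_right : ∀ z ∈ Set.Icc zs l2,
      A z = (a0 - a1) * (zs - l1) * (l2 - z) / (l2 - l1) := by
    intro z hz
    rw [hA, integral_right z hz, integral_right l2 ⟨h2.le, le_rfl⟩]
    field_simp
    ring
  have abs_A_zs : |A zs| = |a0 - a1| * (zs - l1) * (l2 - zs) / (l2 - l1) := by
    rw [A_right zs ⟨le_rfl, h2.le⟩, abs_div, abs_mul, abs_mul, abs_of_pos hL,
      abs_of_pos (sub_pos.2 h1), abs_of_pos (sub_pos.2 h2)]
  refine ⟨A_left, A_right, abs_A_zs, fun z hz hne => ?_⟩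
  have ha' : 0 < |a0 - a1| := abs_pos.2 (sub_ne_zero.2 ha)
  have hzs1 : 0 < zs - l1 := sub_pos.2 h1
  have hzs2 : 0 < l2 - zs := sub_pos.2 h2
  rw [abs_A_zs]
  rcases lt_or_gt_of_ne hne with hlt | hgt
  · rw [A_left z ⟨hz.1, hlt.le⟩, abs_div, abs_mul, abs_mul, abs_of_pos hL, abs_of_pos hzs2,
      abs_of_nonneg (sub_nonneg.2 hz.1), mul_right_comm]
    gcongr
  · rw [A_right z ⟨hgt.le, hz.2⟩, abs_div, abs_mul, abs_mul, abs_of_pos hL, abs_of_pos hzs1,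
      abs_of_nonneg (sub_nonneg.2 hz.2)]
    gcongr
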